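/- arXiv:2406.14729 — 4 statements merged into one kernel-verified Lean document; each statement's English description precedes it below -/
import Mathlib

section
/- Let D be an n×n matrix with non-negative integer entries. Then D admits at least one graph realisation (G, Φ) if and only if D is a distance matrix, i.e. D satisfies: (i) D_ii = 0 for all i ∈ [n] and D_ij > 0 for all i ≠ j; (ii) D is symmetric; (iii) D_iw + D_wj ≥ D_ij for all i, j, w ∈ [n]. -/
/-- `D` is a distance matrix: zero diagonal, positive off-diagonal entries,
symmetric, and satisfies the triangle inequality. -/
def IsDistanceMatrix {α : Type} (D : α → α → ℕ) : Prop :=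
  (∀ i, D i i = 0) ∧ (∀ i j, i ≠ j → 0 < D i j) ∧
    (∀ i j, D i j = D j i) ∧ ∀ i j w, D i j ≤ D i w + D w j

/-- `(G, Φ)` is a graph realisation of `D`: `Φ` is injective and the shortest-path
distance in `G` between `Φ i` and `Φ j` equals `D i j` (in particular it is finite). -/
def IsRealisation {ι V : Type} (G : SimpleGraph V) (Φ : ι → V) (D : ι → ι → ℕ) : Prop :=
  Function.Injective Φ ∧ ∀ i j, G.edist (Φ i) (Φ j) = (D i j : ℕ∞)

/-- The king's graph on the box `ι → Fin N`: distinct points are adjacent when all their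
coordinates differ by at most one. -/
def kingGraph (ι : Type) (N : ℕ) : SimpleGraph (ι → Fin N) where
  Adj u v := u ≠ v ∧ ∀ k, (u k : ℕ) ≤ v k + 1 ∧ (v k : ℕ) ≤ u k + 1
  symm := ⟨fun _ _ h => ⟨h.1.symm, fun k => (h.2 k).symm⟩⟩
  loopless := ⟨fun _ h => h.1 rfl⟩

theorem kingGraph_coord_le_add_length {ι : Type} {N : ℕ} {u v : ι → Fin N}
    (p : (kingGraph ι N).Walk u v) (k : ι) : (u k : ℕ) ≤ v k + p.length := by
  induction p with
  | nil => simp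
  | cons h p ih =>
    have := (h.2 k).1
    rw [SimpleGraph.Walk.length_cons]
    omega

theorem kingGraph_edist_le {ι : Type} {N m : ℕ} {u v : ι → Fin N}
    (h : ∀ k, (u k : ℕ) ≤ v k + m ∧ (v k : ℕ) ≤ u k + m) :
    (kingGraph ι N).edist u v ≤ m := by
  induction m generalizing u with
  | zero =>
    obtain rfl : u = v := funext fun k => Fin.ext (le_antisymm (h k).1 (h k).2)
    simp
  | succ m ih =>
    let w : ι → Fin N := fun k =>
      ⟨if (u k : ℕ) < v k then u k + 1 else if (v k : ℕ) < u k then u k - 1 else u k, by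
        have := (u k).2
        have := (v k).2
        split_ifs <;> omega⟩
    have huw : (kingGraph ι N).edist u w ≤ 1 := by
      rw [SimpleGraph.edist_le_one_iff_adj_or_eq]
      by_cases e : u = w
      · exact Or.inr e
      · refine Or.inl ⟨e, fun k => ?_⟩
        dsimp only [w]
        split_ifs <;> omega
    have hwv : (kingGraph ι N).edist w v ≤ m := by
      refine ih fun k => ?_
      have := h k
      dsimp only [w]
      split_ifs <;> omega
    calc (kingGraph ι N).edist u v
        ≤ (kingGraph ι N).edist u w + (kingGraph ι N).edist w v := SimpleGraph.edist_triangle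
      _ ≤ 1 + m := add_le_add huw hwv
      _ = (m + 1 : ℕ) := by push_cast; exact add_comm _ _

theorem IsRealisation.isDistanceMatrix {ι V : Type} {G : SimpleGraph V} {Φ : ι → V}
    {D : ι → ι → ℕ} (h : IsRealisation G Φ D) : IsDistanceMatrix D := by
  obtain ⟨hΦ, hD⟩ := h
  refine ⟨fun i => ?_, fun i j hij => ?_, fun i j => ?_, fun i j w => ?_⟩
  · have := hD i i
    rw [SimpleGraph.edist_self] at this
    exact_mod_cast this.symm
  · have := SimpleGraph.edist_pos_of_ne (G := G) (hΦ.ne hij)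
    rw [hD] at this
    exact_mod_cast this
  · have := SimpleGraph.edist_comm (G := G) (u := Φ i) (v := Φ j)
    rw [hD, hD] at this
    exact_mod_cast this
  · have := SimpleGraph.edist_triangle (G := G) (u := Φ i) (v := Φ w) (w := Φ j)
    rw [hD, hD, hD] at this
    exact_mod_cast this

/-- The Kuratowski embedding `i ↦ D i ·` realises a bounded distance matrix in the king's graph. -/
theorem IsDistanceMatrix.isRealisation_kingGraph {ι : Type} {D : ι → ι → ℕ} {N : ℕ}
    (h : IsDistanceMatrix D) (hN : ∀ i j, D i j < N) :
    IsRealisation (kingGraph ι N) (fun i k => ⟨D i k, hN i k⟩) D := by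
  obtain ⟨hzero, hpos, hsymm, htri⟩ := h
  refine ⟨fun i j hij => ?_, fun i j => le_antisymm ?_ ?_⟩
  · by_contra hne
    have := congrArg Fin.val (congrFun hij j)
    have := hpos i j hne
    simp_all
  · refine kingGraph_edist_le fun k => ?_
    have h₁ := htri i k j
    have h₂ := htri j k i
    have h₃ := hsymm i j
    dsimp only
    omega
  · rw [SimpleGraph.edist_eq_sInf]
    refine le_sInf ?_
    rintro _ ⟨p, rfl⟩
    have := kingGraph_coord_le_add_length p j
    simp only [hzero j, zero_add] at this
    exact Nat.cast_le.mpr this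

/-- An `n × n` matrix with non-negative integer entries admits at least one graph
realisation if and only if it is a distance matrix. -/
theorem realisation_exists_iff_isDistanceMatrix (n : ℕ) (D : Fin n → Fin n → ℕ) :
    (∃ (V : Type) (_ : Fintype V) (G : SimpleGraph V) (Φ : Fin n → V),
      IsRealisation G Φ D) ↔ IsDistanceMatrix D := by
  constructor
  · rintro ⟨V, _, G, Φ, h⟩
    exact h.isDistanceMatrix
  · intro h
    have hN : ∀ i j, D i j < (∑ i, ∑ j, D i j) + 1 := fun i j => Nat.lt_succ_of_le <|
      (Finset.single_le_sum (f := fun j => D i j) (fun _ _ => Nat.zero_le _)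
        (Finset.mem_univ j)).trans
      (Finset.single_le_sum (f := fun i => ∑ j, D i j) (fun _ _ => Nat.zero_le _)
        (Finset.mem_univ i))
    exact ⟨_, inferInstance, _, _, h.isRealisation_kingGraph hN⟩
end

section
/- Let G_c be a connected simple undirected graph with at least two vertices and let D be the n×n matrix constructed from G_c via the gadget graph. Then D is a distance matrix, i.e. (i) all diagonal entries of D are zero and all off-diagonal entries are strictly positive, (ii) D is symmetric, and (iii) D_iw + D_wj ≥ D_ij for all i, j, w ∈ [n]. -/
/-- The new (interior) vertices of the gadget graph: for each pair `a < b` of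
vertices of `G_c`, two vertices `((a,b), false)` and `((a,b), true)` if `{a,b}` is
an edge of `G_c` (subdividing that edge twice), and one vertex `((a,b), false)` if
`a` and `b` are non-adjacent (the midpoint of an added path of length 2). -/
abbrev GadgetNew (nc : ℕ) (Gc : SimpleGraph (Fin nc)) : Type :=
  {x : (Fin nc × Fin nc) × Bool // x.1.1 < x.1.2 ∧ (x.2 = true → Gc.Adj x.1.1 x.1.2)}

/-- The vertex set of the gadget graph `G_g`: old vertices of `G_c` plus new ones. -/
abbrev GadgetVg (nc : ℕ) (Gc : SimpleGraph (Fin nc)) : Type :=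
  Fin nc ⊕ GadgetNew nc Gc

/-- The gadget graph `G_g`: each edge `{a,b}` of `G_c` (with `a < b`) is replaced by
the path `a — ((a,b),false) — ((a,b),true) — b`, and for each non-adjacent pair
`a < b` the path `a — ((a,b),false) — b` is added. -/
def gadgetGraph (nc : ℕ) (Gc : SimpleGraph (Fin nc)) : SimpleGraph (GadgetVg nc Gc) :=
  SimpleGraph.fromRel fun u v =>
    (∃ x : GadgetNew nc Gc, v = Sum.inr x ∧
      ((Gc.Adj x.1.1.1 x.1.1.2 ∧
          ((x.1.2 = false ∧ u = Sum.inl x.1.1.1) ∨ (x.1.2 = true ∧ u = Sum.inl x.1.1.2))) ∨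
        (¬ Gc.Adj x.1.1.1 x.1.1.2 ∧ (u = Sum.inl x.1.1.1 ∨ u = Sum.inl x.1.1.2)))) ∨
    (∃ x y : GadgetNew nc Gc, u = Sum.inr x ∧ v = Sum.inr y ∧ x.1.1 = y.1.1 ∧
      Gc.Adj x.1.1.1 x.1.1.2 ∧ x.1.2 = false ∧ y.1.2 = true)

/-- The index set of the constructed matrix `D`: the vertices of `G_g` together with
one extra index (the `n`-th row/column). -/
abbrev GadgetIdx (nc : ℕ) (Gc : SimpleGraph (Fin nc)) : Type :=
  GadgetVg nc Gc ⊕ Unit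

/-- The matrix `D` constructed from `G_c` via the gadget graph: `D_ij = d_{G_g}(v_i,v_j)`
for gadget vertices, `D_in = 2` for old vertices, `D_in = 3` for new vertices, `D_nn = 0`. -/
noncomputable def gadgetD (nc : ℕ) (Gc : SimpleGraph (Fin nc)) :
    GadgetIdx nc Gc → GadgetIdx nc Gc → ℕ
  | .inl u, .inl v => (gadgetGraph nc Gc).dist u v
  | .inl (.inl _), .inr _ => 2
  | .inl (.inr _), .inr _ => 3
  | .inr _, .inl (.inl _) => 2
  | .inr _, .inl (.inr _) => 3
  | .inr _, .inr _ => 0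

/-- The first interior vertex of the path joining `a < b` is adjacent to `a`. -/
lemma gadgetGraph_adj_fst {nc : ℕ} {Gc : SimpleGraph (Fin nc)} (x : GadgetNew nc Gc)
    (hx : x.1.2 = false) : (gadgetGraph nc Gc).Adj (.inl x.1.1.1) (.inr x) := by
  rw [gadgetGraph, SimpleGraph.fromRel_adj]
  refine ⟨Sum.inl_ne_inr, .inl (.inl ⟨x, rfl, ?_⟩)⟩
  by_cases h : Gc.Adj x.1.1.1 x.1.1.2
  · exact .inl ⟨h, .inl ⟨hx, rfl⟩⟩
  · exact .inr ⟨h, .inl rfl⟩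

/-- The second interior vertex of a subdivided edge `a < b` is adjacent to `b`. -/
lemma gadgetGraph_adj_snd {nc : ℕ} {Gc : SimpleGraph (Fin nc)} (x : GadgetNew nc Gc)
    (hx : x.1.2 = true) : (gadgetGraph nc Gc).Adj (.inl x.1.1.2) (.inr x) := by
  rw [gadgetGraph, SimpleGraph.fromRel_adj]
  exact ⟨Sum.inl_ne_inr, .inl (.inl ⟨x, rfl, .inl ⟨x.2.2 hx, .inr ⟨hx, rfl⟩⟩⟩)⟩

/-- The midpoint of the path joining non-adjacent `a < b` is adjacent to `b`. -/
lemma gadgetGraph_adj_snd_of_not_adj {nc : ℕ} {Gc : SimpleGraph (Fin nc)} (x : GadgetNew nc Gc)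
    (hx : ¬ Gc.Adj x.1.1.1 x.1.1.2) : (gadgetGraph nc Gc).Adj (.inl x.1.1.2) (.inr x) := by
  rw [gadgetGraph, SimpleGraph.fromRel_adj]
  exact ⟨Sum.inl_ne_inr, .inl (.inl ⟨x, rfl, .inr ⟨hx, .inr rfl⟩⟩)⟩

/-- The two interior vertices of a subdivided edge are adjacent. -/
lemma gadgetGraph_adj_inr_inr {nc : ℕ} {Gc : SimpleGraph (Fin nc)} (x y : GadgetNew nc Gc)
    (hxy : x.1.1 = y.1.1) (hx : x.1.2 = false) (hy : y.1.2 = true) :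
    (gadgetGraph nc Gc).Adj (.inr x) (.inr y) := by
  rw [gadgetGraph, SimpleGraph.fromRel_adj]
  refine ⟨fun h => ?_, .inl (.inr ⟨x, y, rfl, rfl, hxy, hxy ▸ y.2.2 hy, hx, hy⟩)⟩
  rw [Sum.inr.inj h, hy] at hx
  cases hx

/-- Every new vertex of the gadget graph is adjacent to an old one. -/
lemma exists_gadgetGraph_adj_inl {nc : ℕ} {Gc : SimpleGraph (Fin nc)} (x : GadgetNew nc Gc) :
    ∃ a, (gadgetGraph nc Gc).Adj (.inl a) (.inr x) := by
  cases hx : x.1.2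
  · exact ⟨_, gadgetGraph_adj_fst x hx⟩
  · exact ⟨_, gadgetGraph_adj_snd x hx⟩

/-- Any two old vertices of the gadget graph are joined by a walk of length at most 3. -/
lemma exists_gadgetGraph_walk_inl_inl {nc : ℕ} (Gc : SimpleGraph (Fin nc)) (a b : Fin nc) :
    ∃ p : (gadgetGraph nc Gc).Walk (.inl a) (.inl b), p.length ≤ 3 := by
  wlog hab : a ≤ b generalizing a b
  · obtain ⟨p, hp⟩ := this b a (le_of_not_ge hab)
    exact ⟨p.reverse, by simpa using hp⟩
  rcases hab.eq_or_lt with rfl | hlt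
  · exact ⟨.nil, by simp⟩
  let x : GadgetNew nc Gc := ⟨((a, b), false), hlt, by simp⟩
  have hax := gadgetGraph_adj_fst x rfl
  by_cases h : Gc.Adj a b
  · let y : GadgetNew nc Gc := ⟨((a, b), true), hlt, fun _ => h⟩
    exact ⟨.cons hax (.cons (gadgetGraph_adj_inr_inr x y rfl rfl rfl)
      (.cons (gadgetGraph_adj_snd y rfl).symm .nil)), by simp⟩
  · exact ⟨.cons hax (.cons (gadgetGraph_adj_snd_of_not_adj x h).symm .nil), by simp⟩

/-- Every vertex of the gadget graph is joined to any old vertex by a walk. -/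
lemma gadgetGraph_reachable_inl {nc : ℕ} {Gc : SimpleGraph (Fin nc)} (a : Fin nc)
    (u : GadgetVg nc Gc) : (gadgetGraph nc Gc).Reachable (.inl a) u := by
  rcases u with b | x
  · exact ⟨(exists_gadgetGraph_walk_inl_inl Gc a b).choose⟩
  · obtain ⟨b, hb⟩ := exists_gadgetGraph_adj_inl x
    exact .trans ⟨(exists_gadgetGraph_walk_inl_inl Gc a b).choose⟩ hb.reachable

lemma gadgetGraph_connected {nc : ℕ} (Gc : SimpleGraph (Fin nc)) (a : Fin nc) :
    (gadgetGraph nc Gc).Connected where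
  preconnected u v := (gadgetGraph_reachable_inl a u).symm.trans (gadgetGraph_reachable_inl a v)
  nonempty := ⟨.inl a⟩

lemma gadgetGraph_dist_inl_inl_le {nc : ℕ} (Gc : SimpleGraph (Fin nc)) (a b : Fin nc) :
    (gadgetGraph nc Gc).dist (.inl a) (.inl b) ≤ 3 :=
  let ⟨p, hp⟩ := exists_gadgetGraph_walk_inl_inl Gc a b
  (SimpleGraph.dist_le p).trans hp

lemma gadgetGraph_dist_inl_inr_le {nc : ℕ} {Gc : SimpleGraph (Fin nc)} (a : Fin nc)
    (x : GadgetNew nc Gc) : (gadgetGraph nc Gc).dist (.inl a) (.inr x) ≤ 4 := by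
  obtain ⟨b, hb⟩ := exists_gadgetGraph_adj_inl x
  have h := (gadgetGraph_connected Gc a).dist_triangle (u := .inl a) (v := .inl b) (w := .inr x)
  rw [SimpleGraph.dist_eq_one_iff_adj.mpr hb] at h
  exact h.trans (Nat.add_le_add_right (gadgetGraph_dist_inl_inl_le Gc a b) 1)

lemma gadgetGraph_dist_inr_inr_le {nc : ℕ} {Gc : SimpleGraph (Fin nc)}
    (x y : GadgetNew nc Gc) : (gadgetGraph nc Gc).dist (.inr x) (.inr y) ≤ 5 := by
  obtain ⟨a, ha⟩ := exists_gadgetGraph_adj_inl x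
  have h := (gadgetGraph_connected Gc a).dist_triangle (u := .inr x) (v := .inl a) (w := .inr y)
  rw [SimpleGraph.dist_eq_one_iff_adj.mpr ha.symm] at h
  have := gadgetGraph_dist_inl_inr_le a y
  lia

/-- The matrix constructed from a connected graph `G_c` (with at least two vertices)
via the gadget graph is a distance matrix. -/
theorem gadgetD_isDistanceMatrix (nc : ℕ) (Gc : SimpleGraph (Fin nc))
    (hnc : 2 ≤ nc) (hconn : Gc.Connected) :
    IsDistanceMatrix (gadgetD nc Gc) := by
  have hG := gadgetGraph_connected Gc ⟨0, by lia⟩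
  refine ⟨?_, ?_, ?_, ?_⟩
  · rintro (u | _) <;> simp [gadgetD]
  · rintro ((a | x) | _) ((b | y) | _) h <;>
      first
      | exact hG.pos_dist_of_ne (fun h' => h (congrArg Sum.inl h'))
      | exact absurd rfl h
      | simp [gadgetD]
  · rintro ((a | x) | _) ((b | y) | _) <;> simp [gadgetD, SimpleGraph.dist_comm]
  · have hpos (a : Fin nc) (x : GadgetNew nc Gc) :
        0 < (gadgetGraph nc Gc).dist (.inl a) (.inr x) :=
      hG.pos_dist_of_ne Sum.inl_ne_inr
    rintro (u | _) (v | _) (w | _)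
    · exact hG.dist_triangle
    · rcases u with a | x <;> rcases v with b | y <;> simp only [gadgetD]
      · exact (gadgetGraph_dist_inl_inl_le Gc a b).trans (by simp)
      · exact (gadgetGraph_dist_inl_inr_le a y).trans (by simp)
      · rw [SimpleGraph.dist_comm]
        exact (gadgetGraph_dist_inl_inr_le b x).trans (by simp)
      · exact (gadgetGraph_dist_inr_inr_le x y).trans (by simp)
    · rcases u with a | x <;> rcases w with c | z <;> simp only [gadgetD]
      case inr.inl =>
        have := hpos c x
        rw [SimpleGraph.dist_comm] at this
        lia
      all_goals lia
    · simp [gadgetD]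
    · rcases v with b | y <;> rcases w with c | z <;> simp only [gadgetD]
      case inr.inl =>
        have := hpos c y
        lia
      all_goals lia
    all_goals simp [gadgetD]
end

section
/- Let G_c be a connected simple undirected graph with at least two vertices, k ∈ ℕ, and let D be the n×n matrix constructed from G_c via the gadget graph. Let (G = (V,E), Φ) be any graph realisation of D with |V| = n + k, with Φ(i) = v_i for i ∈ [n] and additional vertices v_{n+1},…,v_{n+k} ∈ V ∖ Φ([n]). Then for any two vertices v_i, v_j (i, j ∈ [n_c]) that are adjacent in G_c, there is no vertex v ∈ {v_{n+1},…,v_{n+k}} such that both v_i and v_j are adjacent to v in G. -/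
theorem gadgetGraph_adj_inl {nc : ℕ} {Gc : SimpleGraph (Fin nc)} {a : Fin nc}
    {w : GadgetVg nc Gc} (h : (gadgetGraph nc Gc).Adj (Sum.inl a) w) :
    ∃ x : GadgetNew nc Gc, w = Sum.inr x ∧
      ((Gc.Adj x.1.1.1 x.1.1.2 ∧
          ((x.1.2 = false ∧ a = x.1.1.1) ∨ (x.1.2 = true ∧ a = x.1.1.2))) ∨
        (¬ Gc.Adj x.1.1.1 x.1.1.2 ∧ (a = x.1.1.1 ∨ a = x.1.1.2))) := by
  rw [gadgetGraph, SimpleGraph.fromRel_adj] at h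
  obtain ⟨-, (⟨x, hw, hx⟩ | ⟨x, y, hu, -⟩) | (⟨x, hu, -⟩ | ⟨x, y, -, hu, -⟩)⟩ := h
  · exact ⟨x, hw, by simpa only [Sum.inl.injEq] using hx⟩
  all_goals cases hu

theorem gadgetGraph_not_adj_inl_inl {nc : ℕ} {Gc : SimpleGraph (Fin nc)} (a b : Fin nc) :
    ¬ (gadgetGraph nc Gc).Adj (Sum.inl a) (Sum.inl b) := by
  intro h
  obtain ⟨x, hx, -⟩ := gadgetGraph_adj_inl h
  cases hx

theorem gadgetGraph_no_common_neighbour_of_adj {nc : ℕ} {Gc : SimpleGraph (Fin nc)}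
    {a b : Fin nc} (hab : Gc.Adj a b) (w : GadgetVg nc Gc)
    (ha : (gadgetGraph nc Gc).Adj (Sum.inl a) w)
    (hb : (gadgetGraph nc Gc).Adj (Sum.inl b) w) : False := by
  obtain ⟨x, rfl, hx⟩ := gadgetGraph_adj_inl ha
  obtain ⟨y, hxy, hy⟩ := gadgetGraph_adj_inl hb
  obtain rfl := Sum.inr_injective hxy
  have hne := hab.ne
  have hba := hab.symm
  grind

/-- The hypothesis `h0` excludes the value zero that `dist` takes on unreachable pairs. -/
theorem three_le_gadgetGraph_dist_of_adj {nc : ℕ} {Gc : SimpleGraph (Fin nc)}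
    {a b : Fin nc} (hab : Gc.Adj a b)
    (h0 : (gadgetGraph nc Gc).dist (Sum.inl a) (Sum.inl b) ≠ 0) :
    3 ≤ (gadgetGraph nc Gc).dist (Sum.inl a) (Sum.inl b) := by
  obtain ⟨p, hp⟩ := (SimpleGraph.Reachable.of_dist_ne_zero h0).exists_walk_length_eq_dist
  rw [← hp] at h0 ⊢
  match p with
  | .cons h .nil => exact (gadgetGraph_not_adj_inl_inl _ _ h).elim
  | .cons h (.cons h' .nil) =>
    exact (gadgetGraph_no_common_neighbour_of_adj hab _ h h'.symm).elim
  | .cons _ (.cons _ (.cons _ _)) => simp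

/-- In any graph realisation of the gadget matrix `D` on `n + k` vertices, two
vertices of `G_c` that are adjacent in `G_c` cannot both be adjacent to the same
additional vertex (a vertex outside the image of `Φ`). -/
theorem gadget_adjacent_not_common_neighbour (nc k : ℕ) (hk : 0 < k)
    (Gc : SimpleGraph (Fin nc)) [DecidableRel Gc.Adj]
    (hnc : 2 ≤ nc) (hconn : Gc.Connected)
    (V : Type) [Fintype V] (G : SimpleGraph V) (Φ : GadgetIdx nc Gc → V)
    (hreal : IsRealisation G Φ (gadgetD nc Gc))
    (hcard : Fintype.card V = Fintype.card (GadgetIdx nc Gc) + k) :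
    ∀ i j : Fin nc, Gc.Adj i j → ∀ v : V, v ∉ Set.range Φ →
      ¬(G.Adj (Φ (Sum.inl (Sum.inl i))) v ∧ G.Adj (Φ (Sum.inl (Sum.inl j))) v) := by
  rintro i j hij v - ⟨hi, hj⟩
  obtain ⟨hinj, hdist⟩ := hreal
  have hD : G.edist (Φ (Sum.inl (Sum.inl i))) (Φ (Sum.inl (Sum.inl j))) =
      ((gadgetGraph nc Gc).dist (Sum.inl i) (Sum.inl j) : ℕ∞) := hdist _ _
  have h0 : (gadgetGraph nc Gc).dist (Sum.inl i) (Sum.inl j) ≠ 0 := by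
    intro h0
    rw [h0, Nat.cast_zero, SimpleGraph.edist_eq_zero_iff] at hD
    exact hij.ne (Sum.inl_injective (Sum.inl_injective (hinj hD)))
  have h2 := SimpleGraph.Walk.edist_le (.cons hi (.cons hj.symm .nil))
  have h3 := three_le_gadgetGraph_dist_of_adj hij h0
  rw [hD, Nat.cast_le] at h2
  simp only [SimpleGraph.Walk.length_cons, SimpleGraph.Walk.length_nil] at h2
  omega
end

section
/- Let k ∈ ℕ, let G_c be a connected simple undirected graph with at least two vertices, and let D be the n×n matrix constructed from G_c via the gadget graph. Then G_c is k-colourable (there exists χ : V_c → [k] with χ(u) ≠ χ(v) for every edge {u,v} of G_c) if and only if there exists a graph realisation (G = (V,E), Φ) of D with |V| ≤ n + k. -/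
namespace gadgetGraph

variable {nc : ℕ} {Gc : SimpleGraph (Fin nc)}

lemma adj_inl_inr {a : Fin nc} {x : GadgetNew nc Gc} :
    (gadgetGraph nc Gc).Adj (.inl a) (.inr x) ↔
      (Gc.Adj x.1.1.1 x.1.1.2 ∧ ((x.1.2 = false ∧ a = x.1.1.1) ∨ (x.1.2 = true ∧ a = x.1.1.2))) ∨
        (¬ Gc.Adj x.1.1.1 x.1.1.2 ∧ (a = x.1.1.1 ∨ a = x.1.1.2)) := by
  simp only [gadgetGraph, SimpleGraph.fromRel_adj, Sum.inr.injEq, Sum.inl.injEq, reduceCtorEq,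
    false_and, and_false, exists_false, or_false, ne_eq, not_false_eq_true, true_and]
  constructor
  · rintro ⟨y, rfl, h⟩
    exact h
  · intro h
    exact ⟨x, rfl, h⟩

lemma not_adj_inl_inl (a b : Fin nc) : ¬ (gadgetGraph nc Gc).Adj (.inl a) (.inl b) := by
  simp [gadgetGraph, SimpleGraph.fromRel_adj]

lemma adj_inr_inr {x y : GadgetNew nc Gc} (hxy : x.1.1 = y.1.1) (h : Gc.Adj x.1.1.1 x.1.1.2)
    (hx : x.1.2 = false) (hy : y.1.2 = true) :
    (gadgetGraph nc Gc).Adj (.inr x) (.inr y) := by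
  rw [gadgetGraph, SimpleGraph.fromRel_adj]
  refine ⟨?_, .inl (.inr ⟨x, y, rfl, rfl, hxy, h, hx, hy⟩)⟩
  rintro ⟨⟩
  simp [hx] at hy

/-- Every new vertex has an old neighbour. -/
lemma exists_adj_inl (x : GadgetNew nc Gc) :
    ∃ a, (gadgetGraph nc Gc).Adj (.inl a) (.inr x) := by
  simp only [adj_inl_inr]
  by_cases h : Gc.Adj x.1.1.1 x.1.1.2
  · cases hx : x.1.2
    · exact ⟨_, .inl ⟨h, .inl ⟨rfl, rfl⟩⟩⟩
    · exact ⟨_, .inl ⟨h, .inr ⟨rfl, rfl⟩⟩⟩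
  · exact ⟨_, .inr ⟨h, .inl rfl⟩⟩

lemma exists_walk_of_adj {a b : Fin nc} (h : Gc.Adj a b) :
    ∃ p : (gadgetGraph nc Gc).Walk (.inl a) (.inl b), p.length = 3 := by
  wlog hab : a < b generalizing a b
  · obtain ⟨p, hp⟩ := this h.symm (lt_of_le_of_ne (not_lt.1 hab) h.ne')
    exact ⟨p.reverse, by simpa using hp⟩
  let x : GadgetNew nc Gc := ⟨((a, b), false), hab, fun _ => h⟩
  let y : GadgetNew nc Gc := ⟨((a, b), true), hab, fun _ => h⟩
  have hax : (gadgetGraph nc Gc).Adj (.inl a) (.inr x) := by simp [adj_inl_inr, x, h]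
  have hxy : (gadgetGraph nc Gc).Adj (.inr x) (.inr y) := adj_inr_inr rfl h rfl rfl
  have hby : (gadgetGraph nc Gc).Adj (.inl b) (.inr y) := by simp [adj_inl_inr, y, h]
  exact ⟨.cons hax (.cons hxy (.cons hby.symm .nil)), rfl⟩

lemma exists_walk_of_not_adj {a b : Fin nc} (hne : a ≠ b) (h : ¬ Gc.Adj a b) :
    ∃ p : (gadgetGraph nc Gc).Walk (.inl a) (.inl b), p.length = 2 := by
  wlog hab : a < b generalizing a b
  · obtain ⟨p, hp⟩ := this hne.symm (fun h' => h h'.symm) (lt_of_le_of_ne (not_lt.1 hab) hne.symm)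
    exact ⟨p.reverse, by simpa using hp⟩
  let x : GadgetNew nc Gc := ⟨((a, b), false), hab, fun h => by simp at h⟩
  have hax : (gadgetGraph nc Gc).Adj (.inl a) (.inr x) := by simp [adj_inl_inr, x, h]
  have hbx : (gadgetGraph nc Gc).Adj (.inl b) (.inr x) := by simp [adj_inl_inr, x, h]
  exact ⟨.cons hax (.cons hbx.symm .nil), rfl⟩

lemma dist_inl_inl_le_two {a b : Fin nc} (h : ¬ Gc.Adj a b) :
    (gadgetGraph nc Gc).dist (.inl a) (.inl b) ≤ 2 := by
  rcases eq_or_ne a b with rfl | hne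
  · simp
  · obtain ⟨p, hp⟩ := exists_walk_of_not_adj hne h
    exact hp ▸ SimpleGraph.dist_le p

lemma dist_inl_inl_le_three (a b : Fin nc) :
    (gadgetGraph nc Gc).dist (.inl a) (.inl b) ≤ 3 := by
  by_cases h : Gc.Adj a b
  · obtain ⟨p, hp⟩ := exists_walk_of_adj h
    exact hp ▸ SimpleGraph.dist_le p
  · exact (dist_inl_inl_le_two h).trans (by norm_num)

lemma preconnected (nc : ℕ) (Gc : SimpleGraph (Fin nc)) : (gadgetGraph nc Gc).Preconnected := by
  have old (a b : Fin nc) : (gadgetGraph nc Gc).Reachable (.inl a) (.inl b) := by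
    rcases eq_or_ne a b with rfl | hne
    · rfl
    by_cases h : Gc.Adj a b
    · exact ⟨(exists_walk_of_adj h).choose⟩
    · exact ⟨(exists_walk_of_not_adj hne h).choose⟩
  have toOld (u : GadgetVg nc Gc) : ∃ a, (gadgetGraph nc Gc).Reachable (.inl a) u := by
    rcases u with a | x
    · exact ⟨a, .rfl⟩
    · exact (exists_adj_inl x).imp fun _ h => h.reachable
  intro u v
  obtain ⟨a, ha⟩ := toOld u
  obtain ⟨b, hb⟩ := toOld v
  exact ha.symm.trans ((old a b).trans hb)

lemma two_lt_dist_of_adj {a b : Fin nc} (h : Gc.Adj a b) :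
    2 < (gadgetGraph nc Gc).dist (.inl a) (.inl b) := by
  obtain ⟨p, hp⟩ := (preconnected nc Gc (.inl a) (.inl b)).exists_walk_length_eq_dist
  rw [← hp]
  match p with
  | .nil => exact absurd h (Gc.irrefl)
  | .cons h₁ .nil => exact absurd h₁ (not_adj_inl_inl _ _)
  | .cons (v := .inl c) h₁ _ => exact absurd h₁ (not_adj_inl_inl _ _)
  | .cons (v := .inr x) h₁ (.cons h₂ .nil) =>
    have h₃ := adj_inl_inr.1 h₁
    have h₄ := adj_inl_inr.1 h₂.symm
    have := h.ne
    have := h.symm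
    grind
  | .cons _ (.cons _ (.cons _ _)) => simp

/-- The gadget graph together with an apex joined to `k` colour vertices, where each old vertex
is joined to the vertex of its colour. -/
def withColours {k : ℕ} (χ : Fin nc → Fin k) : SimpleGraph (GadgetIdx nc Gc ⊕ Fin k) :=
  SimpleGraph.fromRel fun
    | .inl (.inl u), .inl (.inl v) => (gadgetGraph nc Gc).Adj u v
    | .inl (.inl (.inl a)), .inr i => χ a = i
    | .inl (.inr _), .inr _ => True
    | _, _ => False

variable {k : ℕ} {χ : Fin nc → Fin k}

lemma withColours_adj_gadget {u v : GadgetVg nc Gc} :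
    (withColours (Gc := Gc) χ).Adj (.inl (.inl u)) (.inl (.inl v)) ↔
      (gadgetGraph nc Gc).Adj u v := by
  simp only [withColours, SimpleGraph.fromRel_adj, SimpleGraph.adj_comm _ v u, or_self, ne_eq,
    Sum.inl.injEq, and_iff_right_iff_imp]
  exact fun h => h.ne

lemma withColours_adj_old_colour {a : Fin nc} {i : Fin k} :
    (withColours (Gc := Gc) χ).Adj (.inl (.inl (.inl a))) (.inr i) ↔ χ a = i := by
  simp [withColours]

lemma withColours_not_adj_new_colour (x : GadgetNew nc Gc) (i : Fin k) :
    ¬ (withColours χ).Adj (.inl (.inl (.inr x))) (.inr i) := by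
  simp [withColours]

lemma withColours_adj_apex_colour (s : Unit) (i : Fin k) :
    (withColours (Gc := Gc) χ).Adj (.inl (.inr s)) (.inr i) := by
  simp [withColours]

lemma withColours_not_adj_gadget_apex (u : GadgetVg nc Gc) (s : Unit) :
    ¬ (withColours χ).Adj (.inl (.inl u)) (.inl (.inr s)) := by
  rcases u with _ | _ <;> simp [withColours]

lemma withColours_not_adj_apex_apex (s t : Unit) :
    ¬ (withColours (Gc := Gc) χ).Adj (.inl (.inr s)) (.inl (.inr t)) := by
  simp [withColours]

lemma withColours_not_adj_colour_colour (i j : Fin k) :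
    ¬ (withColours (Gc := Gc) χ).Adj (.inr i) (.inr j) := by
  simp [withColours]

/-- `WalkBound u L y` bounds the gadget distances from `u` in terms of the length `L` of a walk
from `u` to `y` in the coloured graph. -/
def WalkBound (χ : Fin nc → Fin k) (u : GadgetVg nc Gc) (L : ℕ) :
    GadgetIdx nc Gc ⊕ Fin k → Prop
  | .inl (.inl v) => (gadgetGraph nc Gc).dist u v ≤ L
  | .inl (.inr _) => ∀ a, (gadgetGraph nc Gc).dist u (.inl a) ≤ L + 1
  | .inr i => (∀ a, χ a = i → (gadgetGraph nc Gc).dist u (.inl a) ≤ L + 1) ∧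
      ∀ a, (gadgetGraph nc Gc).dist u (.inl a) ≤ L + 2

lemma WalkBound.step (hχ : ∀ a b, Gc.Adj a b → χ a ≠ χ b) {u : GadgetVg nc Gc} {L : ℕ}
    {y z : GadgetIdx nc Gc ⊕ Fin k} (hy : WalkBound χ u L y) (h : (withColours χ).Adj y z) :
    WalkBound χ u (L + 1) z := by
  have tri (v w : GadgetVg nc Gc) : (gadgetGraph nc Gc).dist u w ≤
      (gadgetGraph nc Gc).dist u v + (gadgetGraph nc Gc).dist v w :=
    (preconnected nc Gc u v).dist_triangle_left w
  rcases y with (v | s) | i <;> rcases z with (w | t) | j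
  · have := SimpleGraph.dist_eq_one_iff_adj.2 (withColours_adj_gadget.1 h)
    have := tri v w
    simp only [WalkBound] at hy ⊢
    omega
  · exact absurd h (withColours_not_adj_gadget_apex v t)
  · rcases v with a | x
    · have hij := withColours_adj_old_colour.1 h
      simp only [WalkBound] at hy ⊢
      refine ⟨fun b hb => ?_, fun b => ?_⟩
      · have := dist_inl_inl_le_two (fun hab => hχ a b hab (hij.trans hb.symm))
        have := tri (.inl a) (.inl b)
        omega
      · have := dist_inl_inl_le_three (Gc := Gc) a b
        have := tri (.inl a) (.inl b)
        omega
    · exact absurd h (withColours_not_adj_new_colour x j)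
  · exact absurd h.symm (withColours_not_adj_gadget_apex w s)
  · exact absurd h (withColours_not_adj_apex_apex s t)
  · simp only [WalkBound] at hy ⊢
    exact ⟨fun b _ => (hy b).trans (by omega), fun b => (hy b).trans (by omega)⟩
  · rcases w with a | x
    · exact hy.1 a (withColours_adj_old_colour.1 h.symm)
    · exact absurd h.symm (withColours_not_adj_new_colour x i)
  · exact hy.2
  · exact absurd h (withColours_not_adj_colour_colour i j)

lemma WalkBound.of_walk (hχ : ∀ a b, Gc.Adj a b → χ a ≠ χ b) {u : GadgetVg nc Gc} {L : ℕ}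
    {y z : GadgetIdx nc Gc ⊕ Fin k} (p : (withColours χ).Walk y z) (hy : WalkBound χ u L y) :
    WalkBound χ u (L + p.length) z := by
  induction p generalizing L with
  | nil => exact hy
  | cons h p ih =>
    rw [SimpleGraph.Walk.length_cons, add_comm p.length, ← add_assoc]
    exact ih (hy.step hχ h)

lemma withColours_edist_gadget (hχ : ∀ a b, Gc.Adj a b → χ a ≠ χ b) (u v : GadgetVg nc Gc) :
    (withColours χ).edist (.inl (.inl u)) (.inl (.inl v)) = (gadgetGraph nc Gc).dist u v := by
  apply le_antisymm
  · obtain ⟨p, hp⟩ := (preconnected nc Gc u v).exists_walk_length_eq_dist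
    let f : gadgetGraph nc Gc →g withColours χ :=
      ⟨fun w => .inl (.inl w), fun h => withColours_adj_gadget.2 h⟩
    rw [← hp, ← SimpleGraph.Walk.length_map f p]
    exact SimpleGraph.edist_le (p.map f)
  · refine le_iInf fun p => ?_
    have h₀ : WalkBound χ u 0 (.inl (.inl u)) := by simp [WalkBound]
    simpa [WalkBound] using h₀.of_walk hχ p

/-- The distance from the apex of the coloured graph. -/
def level : GadgetIdx nc Gc ⊕ Fin k → ℕ
  | .inl (.inl (.inl _)) => 2
  | .inl (.inl (.inr _)) => 3
  | .inl (.inr _) => 0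
  | .inr _ => 1

lemma level_le_of_adj {y z : GadgetIdx nc Gc ⊕ Fin k} (h : (withColours χ).Adj y z) :
    level z ≤ level y + 1 := by
  rcases y with ((a | x) | s) | i <;> rcases z with ((b | y) | t) | j <;> simp only [level] <;>
    first
    | omega
    | exact absurd h.symm (withColours_not_adj_gadget_apex _ _)
    | exact absurd h.symm (withColours_not_adj_new_colour _ _)

lemma level_le_of_walk {y z : GadgetIdx nc Gc ⊕ Fin k} (p : (withColours χ).Walk y z) :
    level z ≤ level y + p.length := by
  induction p with
  | nil => simp
  | cons h p ih =>
    have := level_le_of_adj h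
    rw [SimpleGraph.Walk.length_cons]
    omega

lemma withColours_edist_apex_old (s : Unit) (a : Fin nc) :
    (withColours (Gc := Gc) χ).edist (.inl (.inr s)) (.inl (.inl (.inl a))) = 2 := by
  apply le_antisymm
  · exact SimpleGraph.edist_le (.cons (withColours_adj_apex_colour s (χ a))
      (.cons (withColours_adj_old_colour.2 rfl).symm .nil))
  · refine le_iInf fun p => ?_
    have : 2 ≤ p.length := by simpa [level] using level_le_of_walk p
    exact_mod_cast this

lemma withColours_edist_apex_new (s : Unit) (x : GadgetNew nc Gc) :
    (withColours χ).edist (.inl (.inr s)) (.inl (.inl (.inr x))) = 3 := by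
  apply le_antisymm
  · obtain ⟨a, ha⟩ := exists_adj_inl x
    exact SimpleGraph.edist_le (.cons (withColours_adj_apex_colour s (χ a))
      (.cons (withColours_adj_old_colour.2 rfl).symm
        (.cons (withColours_adj_gadget.2 ha) .nil)))
  · refine le_iInf fun p => ?_
    have : 3 ≤ p.length := by simpa [level] using level_le_of_walk p
    exact_mod_cast this

lemma isRealisation_withColours (hχ : ∀ a b, Gc.Adj a b → χ a ≠ χ b) :
    IsRealisation (withColours χ) Sum.inl (gadgetD nc Gc) := by
  refine ⟨Sum.inl_injective, ?_⟩
  rintro (u | s) (v | t)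
  · rw [withColours_edist_gadget hχ]
    rfl
  · rw [SimpleGraph.edist_comm]
    rcases u with a | x
    · exact withColours_edist_apex_old t a
    · exact withColours_edist_apex_new t x
  · rcases v with a | x
    · exact withColours_edist_apex_old s a
    · exact withColours_edist_apex_new s x
  · simp [gadgetD]

lemma exists_adj_adj_of_length_eq_two {V : Type*} {G : SimpleGraph V} {u v : V} (p : G.Walk u v)
    (hp : p.length = 2) : ∃ c, G.Adj u c ∧ G.Adj c v :=
  match p, hp with
  | .cons h₁ (.cons h₂ .nil), _ => ⟨_, h₁, h₂⟩

/-- In a realisation, each old vertex has a neighbour outside the image of the index set, namely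
its common neighbour with the last index. -/
lemma exists_adj_compl_range_of_isRealisation {V : Type} {G : SimpleGraph V} {Φ : GadgetIdx nc Gc → V}
    (h : IsRealisation G Φ (gadgetD nc Gc)) (a : Fin nc) :
    ∃ c : ((Set.range Φ)ᶜ : Set V), G.Adj (Φ (.inl (.inl a))) c := by
  obtain ⟨p, hp⟩ := SimpleGraph.exists_walk_of_edist_eq_coe (h.2 (.inl (.inl a)) (.inr ()))
  obtain ⟨c, h₁, h₂⟩ := exists_adj_adj_of_length_eq_two p hp
  refine ⟨⟨c, ?_⟩, h₁⟩
  rintro ⟨i, rfl⟩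
  have h₃ := SimpleGraph.edist_eq_one_iff_adj.2 h₂
  rw [h.2] at h₃
  rcases i with (b | x) | t <;> simp [gadgetD] at h₃

lemma colorable_of_isRealisation [DecidableRel Gc.Adj] {V : Type} [Fintype V] {G : SimpleGraph V}
    {Φ : GadgetIdx nc Gc → V} (h : IsRealisation G Φ (gadgetD nc Gc))
    (hV : Fintype.card V ≤ Fintype.card (GadgetIdx nc Gc) + k) : Gc.Colorable k := by
  classical
  choose c hc using exists_adj_compl_range_of_isRealisation h
  let C : Gc.Coloring ((Set.range Φ)ᶜ : Set V) := SimpleGraph.Coloring.mk c fun {a b} hab hcol => by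
    have hle : G.edist (Φ (.inl (.inl a))) (Φ (.inl (.inl b))) ≤ 2 :=
      SimpleGraph.edist_le (.cons (hc a) (.cons (hcol ▸ (hc b).symm) .nil))
    rw [h.2] at hle
    have : (gadgetGraph nc Gc).dist (.inl a) (.inl b) ≤ 2 := by exact_mod_cast hle
    exact absurd this (not_le.2 (two_lt_dist_of_adj hab))
  refine C.colorable.mono ?_
  rw [Fintype.card_compl_set, Set.card_range_of_injective h.1]
  omega

end gadgetGraph

/-- `G_c` is `k`-colourable if and only if the gadget matrix `D` constructed from
`G_c` has a graph realisation with at most `n + k` vertices. -/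
theorem gadget_colourable_iff_realisation (nc k : ℕ) (hk : 0 < k)
    (Gc : SimpleGraph (Fin nc)) [DecidableRel Gc.Adj]
    (hnc : 2 ≤ nc) (hconn : Gc.Connected) :
    Gc.Colorable k ↔
      ∃ (V : Type) (_ : Fintype V) (G : SimpleGraph V) (Φ : GadgetIdx nc Gc → V),
        IsRealisation G Φ (gadgetD nc Gc) ∧
        Fintype.card V ≤ Fintype.card (GadgetIdx nc Gc) + k := by
  constructor
  · rintro ⟨C⟩
    exact ⟨_, inferInstance, gadgetGraph.withColours C, Sum.inl,
      gadgetGraph.isRealisation_withColours fun _ _ h => C.valid h,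
      by rw [Fintype.card_sum, Fintype.card_fin]⟩
  · rintro ⟨V, _, G, Φ, h, hV⟩
    exact gadgetGraph.colorable_of_isRealisation h hV
end
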